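/- arXiv:2509.04231 — 2 statements merged into one kernel-verified Lean document; each statement's English description precedes it below -/
import Mathlib

section
/- Equivalence of the SENS rejection set and the e-BH rejection set (Proposition 3). Fix α ∈ (0,1), m ≥ 1, and real numbers G_1,…,G_m. Let τ = inf{ λ ∈ {|G_1|,…,|G_m|} : (1 + Σ_{j=1}^m 1{G_j ≤ −λ}) / max(Σ_{j=1}^m 1{G_j ≥ λ}, 1) ≤ α } (τ = +∞ if the set is empty), and define e_i = m · 1{G_i ≥ τ} / (1 + Σ_{j=1}^m 1{G_j ≤ −τ}) for i ∈ [m], with e_i = 0 when τ = +∞. Let e_{(1)} ≥ e_{(2)} ≥ ⋯ ≥ e_{(m)} be the nonincreasing rearrangement of (e_1,…,e_m), let k̂ = max{ i ∈ [m] : i·e_{(i)}/m ≥ 1/α } (when this set is nonempty), and let R_ebh = { i ∈ [m] : e_i ≥ e_{(k̂)} }, with R_ebh = ∅ when the defining set for k̂ is empty. Let R = { i ∈ [m] : G_i ≥ τ }. Then R_ebh = R. -/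
open scoped Classical

/-- The mirror threshold `τ`: the infimum (in the extended reals, so `+∞` when the set
is empty) of the values `λ ∈ {|G 1|, …, |G m|}` at which the mirror FDP estimate
`(1 + #{j : G j ≤ −λ}) / max(#{j : G j ≥ λ}, 1)` is at most `α`. -/
noncomputable def mirrorThreshold {m : ℕ} (α : ℝ) (G : Fin m → ℝ) : EReal :=
  sInf ((fun x : ℝ => (x : EReal)) ''
    {x : ℝ | (∃ i, |G i| = x) ∧
      ((1 : ℝ) + ((Finset.univ.filter fun j => G j ≤ -x).card : ℝ)) /
        max ((Finset.univ.filter fun j => x ≤ G j).card : ℝ) 1 ≤ α})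

/-- The mirror e-values `e i = m·1{G i ≥ τ}/(1 + #{j : G j ≤ −τ})`; when `τ = +∞` the
indicator vanishes, so `e i = 0`. -/
noncomputable def mirrorEValue {m : ℕ} (α : ℝ) (G : Fin m → ℝ) (i : Fin m) : ℝ :=
  (m : ℝ) * (if mirrorThreshold α G ≤ (G i : EReal) then (1 : ℝ) else 0) /
    ((1 : ℝ) + ((Finset.univ.filter fun j =>
        (G j : EReal) ≤ -(mirrorThreshold α G)).card : ℝ))

/-- The nonincreasing rearrangement `e_(1) ≥ ⋯ ≥ e_(m)` of a tuple (via `Tuple.sort`,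
which sorts nondecreasingly, composed with index reversal): `sortedDesc e i` is the
`(i+1)`-th largest value. -/
noncomputable def sortedDesc {m : ℕ} (e : Fin m → ℝ) (i : Fin m) : ℝ :=
  e (Tuple.sort e i.rev)

/-- The e-BH procedure at level `α`: with `e_(1) ≥ ⋯ ≥ e_(m)` the nonincreasing
rearrangement and `k̂ = max{ i : i·e_(i)/m ≥ 1/α }`, reject `{ i : e i ≥ e_(k̂) }`
(and reject nothing when no such `k̂` exists). -/
noncomputable def ebh {m : ℕ} (α : ℝ) (e : Fin m → ℝ) : Finset (Fin m) :=
  if h : (Finset.univ.filter fun k : Fin m =>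
      1 / α ≤ (((k : ℕ) : ℝ) + 1) * sortedDesc e k / m).Nonempty then
    Finset.univ.filter fun i =>
      sortedDesc e ((Finset.univ.filter fun k : Fin m =>
        1 / α ≤ (((k : ℕ) : ℝ) + 1) * sortedDesc e k / m).max' h) ≤ e i
  else ∅

/-- **Equivalence of the SENS rejection set and the e-BH rejection set (Proposition 3).**
Applying the e-BH procedure at level `α` to the mirror e-values yields exactly the
mirror rejection set `{ i : G i ≥ τ }`. -/
theorem sens_rejection_eq_ebh_rejection
    (m : ℕ) (hm : 1 ≤ m) (α : ℝ) (hα : α ∈ Set.Ioo (0 : ℝ) 1) (G : Fin m → ℝ) :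
    ebh α (fun i => mirrorEValue α G i)
      = Finset.univ.filter fun i => mirrorThreshold α G ≤ (G i : EReal) := by
  obtain ⟨hα0, hα1⟩ := hα
  have hm0 : (0 : ℝ) < m := by exact_mod_cast hm
  set τ := mirrorThreshold α G with hτ
  set N : ℝ := ((Finset.univ.filter fun j => (G j : EReal) ≤ -τ).card : ℝ) with hN
  have hN0 : 0 ≤ N := by positivity
  set e : Fin m → ℝ := fun i => mirrorEValue α G i with he
  set c : ℝ := (m : ℝ) / (1 + N) with hc
  have hc0 : 0 < c := by positivity
  have e1 : ∀ i, τ ≤ (G i : EReal) → e i = c := by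
    intro i hi
    simp only [he, mirrorEValue, ← hτ, if_pos hi, mul_one, ← hN, hc]
  have e0 : ∀ i, ¬ τ ≤ (G i : EReal) → e i = 0 := by
    intro i hi
    simp only [he, mirrorEValue, ← hτ, if_neg hi, mul_zero, zero_div]
  unfold ebh
  split_ifs with h
  · have hk := Finset.max'_mem _ h
    generalize Finset.max' _ h = k at hk ⊢
    simp only [Finset.mem_filter, Finset.mem_univ, true_and] at hk
    have hs : sortedDesc e k = c := by
      unfold sortedDesc at hk ⊢
      by_cases hi : τ ≤ (G (Tuple.sort e k.rev) : EReal)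
      · exact e1 _ hi
      · rw [e0 _ hi] at hk
        have : 0 < 1 / α := by positivity
        simp at hk
        linarith
    ext i
    simp only [Finset.mem_filter, Finset.mem_univ, true_and, hs]
    by_cases hi : τ ≤ (G i : EReal)
    · simp [e1 i hi, hi]
    · simp [e0 i hi, hi, hc0]
  · symm
    by_contra hR
    apply h
    set R := Finset.univ.filter fun i => τ ≤ (G i : EReal) with hRdef
    obtain ⟨i0, hi0⟩ := Finset.nonempty_iff_ne_empty.mpr hR
    have hi0' : τ ≤ (G i0 : EReal) := by simpa [hRdef] using hi0
    have hRpos : 0 < R.card := Finset.card_pos.mpr ⟨i0, hi0⟩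
    have hRm : R.card ≤ m := by simpa using Finset.card_le_univ R
    -- the threshold is attained
    have hatt : τ ∈ ((fun x : ℝ => (x : EReal)) ''
        {x : ℝ | (∃ i, |G i| = x) ∧
          ((1 : ℝ) + ((Finset.univ.filter fun j => G j ≤ -x).card : ℝ)) /
          max ((Finset.univ.filter fun j => x ≤ G j).card : ℝ) 1 ≤ α}) := by
      apply Set.Nonempty.csInf_mem
      · by_contra hne
        rw [Set.not_nonempty_iff_eq_empty] at hne
        have : τ = ⊤ := by rw [hτ, mirrorThreshold, hne, sInf_empty]
        rw [this] at hi0'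
        exact (EReal.coe_ne_top _) (top_le_iff.mp hi0')
      · apply Set.Finite.image
        exact (Set.finite_range fun i => |G i|).subset (fun x hx => hx.1)
    obtain ⟨x, ⟨-, hx⟩, hxτ⟩ := hatt
    have hxτ' : τ = (x : EReal) := hxτ.symm
    have hNx : ((Finset.univ.filter fun j => G j ≤ -x).card : ℝ) = N := by
      rw [hN, hxτ']
      congr 2
      ext j
      simp only [Finset.mem_filter, Finset.mem_univ, true_and]
      rw [← EReal.coe_neg, EReal.coe_le_coe_iff]
    have hRx : (Finset.univ.filter fun j => x ≤ G j) = R := by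
      rw [hRdef, hxτ']
      ext j
      simp only [Finset.mem_filter, Finset.mem_univ, true_and, EReal.coe_le_coe_iff]
    rw [hNx, hRx] at hx
    have hR1 : (1 : ℝ) ≤ R.card := by exact_mod_cast hRpos
    rw [max_eq_left hR1, div_le_iff₀ (by linarith)] at hx
    let k : Fin m := ⟨R.card - 1, by omega⟩
    have hs : sortedDesc e k = c := by
      by_cases hi : τ ≤ (G (Tuple.sort e k.rev) : EReal)
      · exact e1 _ hi
      · exfalso
        have hz := e0 _ hi
        have hsub : (Finset.Iic k.rev).map (Tuple.sort e).toEmbedding ⊆ Rᶜ := by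
          intro j hj
          simp only [Finset.mem_map, Finset.mem_Iic] at hj
          obtain ⟨a, ha, rfl⟩ := hj
          have hmono := Tuple.monotone_sort e ha
          simp only [Function.comp] at hmono
          simp only [hRdef, Finset.mem_compl, Finset.mem_filter, Finset.mem_univ, true_and]
          intro hcon
          have := e1 _ hcon
          simp only [Equiv.coe_toEmbedding] at this
          linarith
        have hcard := Finset.card_le_card hsub
        rw [Finset.card_map, Finset.card_compl, Fin.card_Iic, Fintype.card_fin,
          Fin.val_rev] at hcard
        simp only [k] at hcard
        omega
    refine ⟨k, ?_⟩
    simp only [Finset.mem_filter, Finset.mem_univ, true_and]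
    rw [hs, hc]
    have hk : (((k : ℕ) : ℝ) + 1) = R.card := by
      have : (k : ℕ) + 1 = R.card := by simp only [k]; omega
      exact_mod_cast this
    rw [hk]
    have : (R.card : ℝ) * (m / (1 + N)) / m = R.card / (1 + N) := by
      field_simp
    rw [this, div_le_div_iff₀ hα0 (by linarith)]
    linarith
end

section
/- Failure of exchangeability when standardizing with the full-sample standard deviation (counter-example Proposition). Let n ≥ 2 be an even integer and let X_1,…,X_n be i.i.d. standard normal random variables. Partition [n] into two halves N₁ and N₂ of size n/2 each, and let X̄₁, X̄₂ be the corresponding half-sample means. Let X̄ = n⁻¹ Σ_j X_j and S* = √( (n−1)⁻¹ Σ_{j=1}^n (X_j − X̄)² ) be the full-sample mean and standard deviation. Then: (a) X̄₁ + X̄₂ is independent of S*; and (b) the random variables (X̄₁ + X̄₂)/S* and (X̄₁ − X̄₂)/S* do NOT have the same distribution. Consequently, for any strictly increasing continuous function h : ℝ → ℝ, the statistics T* = h((X̄₁ + X̄₂)/S*) and T^{0,*} = h((X̄₁ − X̄₂)/S*) are not equal in distribution, so the pairwise exchangeability condition fails for this construction. -/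
open MeasureTheory ProbabilityTheory
open scoped Classical

/-- Sample mean of the values `x j`, `j ∈ s`. -/
noncomputable def sampleMean {ι : Type*} (s : Finset ι) (x : ι → ℝ) : ℝ :=
  (∑ j ∈ s, x j) / s.card

lemma aux_gauss_openPos : (gaussianReal 0 1).IsOpenPosMeasure :=
  (gaussianReal_absolutelyContinuous' 0 one_ne_zero).isOpenPosMeasure

lemma aux_indep {Ω : Type*} [MeasurableSpace Ω] (P : Measure Ω) [IsProbabilityMeasure P]
    (n : ℕ) (hn : 2 ≤ n) (X : Fin n → Ω → ℝ) (hXmeas : ∀ j, Measurable (X j))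
    (hiid : Measure.map (fun ω => fun j => X j ω) P
      = Measure.pi fun _ : Fin n => gaussianReal 0 1) :
    IndepFun (fun ω (_ : Unit) => (∑ j, X j ω) / (n : ℝ))
      (fun ω j => X j ω - (∑ i, X i ω) / (n : ℝ)) P := by
  have hm : ∀ j, Measure.map (X j) P = gaussianReal 0 1 := by
    intro j
    have h := congrArg (Measure.map (Function.eval j)) hiid
    rw [Measure.map_map (by fun_prop) (by fun_prop)] at h
    rw [(measurePreserving_eval (fun _ : Fin n => gaussianReal 0 1) j).map_eq] at h
    exact h
  have hind : iIndepFun X P := by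
    rw [iIndepFun_iff_map_fun_eq_pi_map (fun j => (hXmeas j).aemeasurable), hiid]
    simp [hm]
  have hlaw : ∀ j, HasGaussianLaw (X j) P := fun j =>
    ⟨by rw [hm j]; infer_instance⟩
  have hG := hind.hasGaussianLaw hlaw
  have hL : ∀ j, MemLp (X j) 2 P := fun j => (hlaw j).memLp_two
  have hvar : ∀ j, Var[X j; P] = 1 := by
    intro j
    have := variance_id_gaussianReal (μ := 0) (v := 1)
    rw [← hm j, variance_map (by fun_prop) (by fun_prop)] at this
    simpa using this
  have hcov : ∀ i j, cov[X i, X j; P] = if i = j then 1 else 0 := by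
    intro i j
    split_ifs with h
    · subst h
      rw [covariance_self (hXmeas i).aemeasurable, hvar]
    · exact (hind.indepFun h).covariance_eq_zero (hL i) (hL j)
  have hn0 : (n : ℝ) ≠ 0 := by positivity
  refine HasGaussianLaw.indepFun_of_covariance_eval
    (X := fun (_ : Unit) ω => (∑ j, X j ω) / (n : ℝ))
    (Y := fun j ω => X j ω - (∑ i, X i ω) / (n : ℝ)) ?_ ?_
  · let p : (Fin n → ℝ) →L[ℝ] ℝ :=
      (n : ℝ)⁻¹ • ∑ i, ContinuousLinearMap.proj (R := ℝ) (φ := fun _ : Fin n => ℝ) i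
    let L : (Fin n → ℝ) →L[ℝ] (Unit → ℝ) × (Fin n → ℝ) :=
      (ContinuousLinearMap.pi fun _ => p).prod
        (ContinuousLinearMap.pi fun j => ContinuousLinearMap.proj j - p)
    have := hG.map_fun L
    refine this.congr (Filter.Eventually.of_forall fun ω => ?_)
    simp [L, p, div_eq_inv_mul]
  · intro _ j
    have hsum : MemLp (fun ω => ∑ i, X i ω) 2 P := memLp_finsetSum _ (fun i _ => hL i)
    have hdiv : MemLp (fun ω => (∑ i, X i ω) / (n : ℝ)) 2 P := by
      simpa [div_eq_mul_inv] using hsum.mul_const ((n : ℝ)⁻¹)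
    rw [covariance_fun_sub_right hdiv (hL j) hdiv]
    simp only [covariance_fun_div_left, covariance_fun_div_right]
    rw [covariance_fun_sum_left hL (hL j), covariance_fun_sum_fun_sum hL hL]
    simp [hcov]
    field_simp
    simp

/-- The pathwise bound for the half-sample difference. -/
lemma aux_bound {n : ℕ} (hn : 2 ≤ n) (N : Finset (Fin n)) (hN : N.Nonempty) (x : Fin n → ℝ)
    (b : ℝ) : |sampleMean N x - b| ≤ Real.sqrt (∑ j, (x j - b) ^ 2) := by
  have hc : (0 : ℝ) < N.card := by exact_mod_cast hN.card_pos
  have h1 : sampleMean N x - b = (∑ j ∈ N, (x j - b)) / N.card := by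
    unfold sampleMean
    rw [Finset.sum_sub_distrib]
    simp
    field_simp
  rw [h1, abs_div, abs_of_pos hc, div_le_iff₀ hc]
  refine (Finset.abs_sum_le_sum_abs _ _).trans ?_
  have : ∀ j ∈ N, |x j - b| ≤ Real.sqrt (∑ j, (x j - b) ^ 2) := by
    intro j _
    apply Real.abs_le_sqrt
    exact Finset.single_le_sum (f := fun j => (x j - b) ^ 2) (fun i _ => sq_nonneg _)
      (Finset.mem_univ j)
  refine (Finset.sum_le_card_nsmul _ _ _ this).trans ?_
  rw [nsmul_eq_mul, mul_comm]

lemma aux_pos {n : ℕ} (hn : 2 ≤ n) (C : ℝ) :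
    (Measure.pi fun _ : Fin n => gaussianReal 0 1)
      {x | C < 2 * ((∑ j, x j) / n) /
        Real.sqrt ((∑ j, (x j - (∑ j, x j) / n) ^ 2) / ((n : ℝ) - 1))} ≠ 0 := by
  have hn1 : (0 : ℝ) < (n : ℝ) - 1 := by
    have : (2 : ℝ) ≤ n := by exact_mod_cast hn
    linarith
  have hn0 : (0 : ℝ) < n := by linarith
  haveI := aux_gauss_openPos
  let S : (Fin n → ℝ) → ℝ := fun x =>
    Real.sqrt ((∑ j, (x j - (∑ j, x j) / n) ^ 2) / ((n : ℝ) - 1))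
  have hSc : Continuous S := by
    apply Real.continuous_sqrt.comp
    fun_prop
  let U : Set (Fin n → ℝ) := {x | C * S x < 2 * ((∑ j, x j) / n)} ∩ {x | 0 < S x}
  have hU : IsOpen U := by
    refine (isOpen_lt (by fun_prop) (by fun_prop)).inter (isOpen_lt (by fun_prop) hSc)
  let e : Fin n → ℝ := Pi.single ⟨0, by omega⟩ 1
  have hshift : ∀ t : ℝ, (∑ j, (e j + t)) / (n : ℝ) = 1 / n + t := by
    intro t
    rw [Finset.sum_add_distrib]
    simp [e]
    field_simp
  have hSe : ∀ t : ℝ, S (fun j => e j + t) = S e := by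
    intro t
    have h0 := hshift 0
    simp only [add_zero] at h0
    simp only [S, hshift, h0, add_sub_add_right_eq_sub]
  have hpos : 0 < S e := by
    apply Real.sqrt_pos.2
    apply div_pos _ hn1
    refine Finset.sum_pos' (fun i _ => sq_nonneg _) ⟨⟨1, by omega⟩, Finset.mem_univ _, ?_⟩
    have h0 := hshift 0
    simp only [add_zero] at h0
    rw [h0]
    have : e ⟨1, by omega⟩ = 0 := by simp [e]
    rw [this]
    have : (1 : ℝ) / n > 0 := by positivity
    nlinarith
  have hne : U.Nonempty := by
    refine ⟨fun j => e j + (|C * S e|), ?_, ?_⟩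
    · simp only [Set.mem_ofPred_eq, hSe, hshift]
      have : (1 : ℝ) / n > 0 := by positivity
      have := le_abs_self (C * S e)
      have := abs_nonneg (C * S e)
      linarith
    · simp only [Set.mem_ofPred_eq, hSe]
      exact hpos
  have := hU.measure_ne_zero (Measure.pi fun _ : Fin n => gaussianReal 0 1) hne
  intro h0
  apply this
  refine measure_mono_null ?_ h0
  rintro x ⟨hx1, hx2⟩
  simp only [Set.mem_ofPred_eq] at hx1 hx2 ⊢
  exact (lt_div_iff₀ hx2).2 hx1

/-- **Failure of exchangeability when standardizing with the full-sample standard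
deviation (counter-example Proposition).**
For an even number `n ≥ 2` of i.i.d. standard normal observations split into two
halves, the sum of the half-sample means is independent of the full-sample standard
deviation `S*`, yet `(X̄₁ + X̄₂)/S*` and `(X̄₁ − X̄₂)/S*` are not equal in distribution;
consequently, for any strictly increasing continuous transformation `h`, the statistics
`T* = h((X̄₁ + X̄₂)/S*)` and `T⁰* = h((X̄₁ − X̄₂)/S*)` are not equal in distribution
either, so pairwise exchangeability fails. -/
theorem full_sample_sd_breaks_exchangeability
    {Ω : Type*} [MeasurableSpace Ω] (P : Measure Ω) [IsProbabilityMeasure P]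
    (n : ℕ) (hn : 2 ≤ n) (heven : Even n)
    (X : Fin n → Ω → ℝ) (hXmeas : ∀ j, Measurable (X j))
    -- i.i.d. standard normal observations
    (hiid : Measure.map (fun ω => fun j => X j ω) P
      = Measure.pi fun _ : Fin n => gaussianReal 0 1)
    (N₁ N₂ : Finset (Fin n))
    (hdisj : Disjoint N₁ N₂) (hunion : N₁ ∪ N₂ = Finset.univ)
    (hcard : N₁.card = n / 2)
    (Xbar₁ Xbar₂ Xbar Sstar : Ω → ℝ)
    (h₁ : ∀ ω, Xbar₁ ω = sampleMean N₁ fun j => X j ω)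
    (h₂ : ∀ ω, Xbar₂ ω = sampleMean N₂ fun j => X j ω)
    (hbar : ∀ ω, Xbar ω = (∑ j, X j ω) / n)
    (hS : ∀ ω, Sstar ω = Real.sqrt ((∑ j, (X j ω - Xbar ω) ^ 2) / ((n : ℝ) - 1))) :
    IndepFun (fun ω => Xbar₁ ω + Xbar₂ ω) Sstar P ∧
    Measure.map (fun ω => (Xbar₁ ω + Xbar₂ ω) / Sstar ω) P
      ≠ Measure.map (fun ω => (Xbar₁ ω - Xbar₂ ω) / Sstar ω) P ∧
    ∀ h : ℝ → ℝ, StrictMono h → Continuous h →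
      Measure.map (fun ω => h ((Xbar₁ ω + Xbar₂ ω) / Sstar ω)) P
        ≠ Measure.map (fun ω => h ((Xbar₁ ω - Xbar₂ ω) / Sstar ω)) P := by
  obtain ⟨m, rfl⟩ := heven
  have hm : 0 < m := by omega
  have hcard1 : N₁.card = m := by omega
  have hcard2 : N₂.card = m := by
    have := Finset.card_union_of_disjoint hdisj
    rw [hunion, Finset.card_univ, Fintype.card_fin] at this
    omega
  have hm0 : (0 : ℝ) < m := by exact_mod_cast hm
  have hn1 : (0 : ℝ) < ((m + m : ℕ) : ℝ) - 1 := by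
    have : (2 : ℝ) ≤ ((m + m : ℕ) : ℝ) := by exact_mod_cast hn
    linarith
  have hadd : ∀ ω, Xbar₁ ω + Xbar₂ ω = 2 * ((∑ j, X j ω) / ((m + m : ℕ) : ℝ)) := by
    intro ω
    rw [h₁, h₂, ← hunion, Finset.sum_union hdisj]
    simp only [sampleMean, hcard1, hcard2]
    push_cast
    field_simp
    ring
  have hSm : Measurable Sstar := by
    have : Sstar = _ := funext hS
    rw [this]
    simp only [hbar]
    fun_prop
  have hAm : Measurable (fun ω => Xbar₁ ω + Xbar₂ ω) := by
    simp only [hadd]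
    fun_prop
  have hDm : Measurable (fun ω => Xbar₁ ω - Xbar₂ ω) := by
    simp only [h₁, h₂, sampleMean]
    fun_prop
  have key : ∀ h : ℝ → ℝ, StrictMono h → Continuous h →
      Measure.map (fun ω => h ((Xbar₁ ω + Xbar₂ ω) / Sstar ω)) P
        ≠ Measure.map (fun ω => h ((Xbar₁ ω - Xbar₂ ω) / Sstar ω)) P := by
    intro h hmono hcont heq
    set C : ℝ := 2 * Real.sqrt (((m + m : ℕ) : ℝ) - 1) with hC
    have hle : ∀ ω, (Xbar₁ ω - Xbar₂ ω) / Sstar ω ≤ C := by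
      intro ω
      have hS0 : 0 ≤ Sstar ω := by rw [hS]; positivity
      refine div_le_of_le_mul₀ hS0 (by positivity) ?_
      have b1 := aux_bound hn N₁ (Finset.card_pos.1 (by omega)) (fun j => X j ω) (Xbar ω)
      have b2 := aux_bound hn N₂ (Finset.card_pos.1 (by omega)) (fun j => X j ω) (Xbar ω)
      rw [← h₁] at b1
      rw [← h₂] at b2
      have : Real.sqrt (∑ j, (X j ω - Xbar ω) ^ 2)
          = Real.sqrt (((m + m : ℕ) : ℝ) - 1) * Sstar ω := by
        rw [hS, ← Real.sqrt_mul hn1.le, mul_div_cancel₀ _ hn1.ne']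
      rw [this] at b1 b2
      have c1 := (abs_le.1 b1).2
      have c2 := (abs_le.1 b2).1
      rw [hC]
      linarith
    have hval := congrArg (fun μ => μ (Set.Ioi (h C))) heq
    have hm1 : Measurable (fun ω => h ((Xbar₁ ω + Xbar₂ ω) / Sstar ω)) :=
      hcont.measurable.comp (hAm.div hSm)
    have hm2 : Measurable (fun ω => h ((Xbar₁ ω - Xbar₂ ω) / Sstar ω)) :=
      hcont.measurable.comp (hDm.div hSm)
    rw [Measure.map_apply hm1 measurableSet_Ioi,
      Measure.map_apply hm2 measurableSet_Ioi] at hval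
    have hz : (fun ω => h ((Xbar₁ ω - Xbar₂ ω) / Sstar ω)) ⁻¹' Set.Ioi (h C) = ∅ := by
      ext ω
      simp only [Set.mem_preimage, Set.mem_Ioi, hmono.lt_iff_lt, Set.mem_empty_iff_false,
        iff_false, not_lt]
      exact hle ω
    rw [hz, measure_empty] at hval
    have hp := aux_pos hn C
    rw [← hiid, Measure.map_apply (by fun_prop)
      (measurableSet_lt (by fun_prop) (by fun_prop))] at hp
    apply hp
    convert hval using 2
    ext ω
    simp only [Set.mem_preimage, Set.mem_Ioi, hmono.lt_iff_lt, Set.mem_ofPred_eq, hadd, hS, hbar]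
  refine ⟨?_, ?_, key⟩
  · have hI := aux_indep P (m + m) hn X hXmeas hiid
    have := hI.comp (φ := fun u : Unit → ℝ => 2 * u ())
      (ψ := fun y : Fin (m + m) → ℝ => Real.sqrt ((∑ j, y j ^ 2) / (((m + m : ℕ) : ℝ) - 1)))
      (by fun_prop) (by fun_prop)
    convert this using 1
    · funext ω
      simp [hadd]
    · funext ω
      simp [hS, hbar]
  · exact key id strictMono_id continuous_id
end
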